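/- arXiv:1810.04899 — 2 statements merged into one kernel-verified Lean document; each statement's English description precedes it below -/
import Mathlib

section
/- Let (V, ω) be a VOA of CFT type. If a ∈ CV_sCFT ∩ V_{≥2}, then pr_2(a) ∈ CV_sCFT. -/
/-!
Common framework: vertex algebras, ℤ-graded (conformal) vertex algebras,
conformal vectors, automorphism groups, following Moriwaki,
"On classification of conformal vectors in vertex operator algebra and
the vertex algebra automorphism group".
-/

noncomputable section

open scoped BigOperators

/-- The generalized binomial coefficient `binom(m, i)` for `m : ℤ`, valued in a field `K`. -/
def zBinom (K : Type*) [Field K] (m : ℤ) (i : ℕ) : K :=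
  (∏ j ∈ Finset.range i, ((m : K) - (j : K))) / (Nat.factorial i : K)

/-- A vertex algebra over a field `K`: a `K`-vector space `V` equipped with bilinear
`n`-th products `a(n)b` (`n : ℤ`) and a vacuum vector `𝟙`, subject to the truncation
condition, the vacuum and creation axioms, and the Borcherds identity. -/
structure VA (K V : Type*) [Field K] [AddCommGroup V] [Module K V] where
  /-- the `n`-th product `a(n)b`, bilinear in `a` and `b` -/
  ncoef : ℤ → V →ₗ[K] V →ₗ[K] V
  /-- the vacuum vector `𝟙` -/
  vac : V
  /-- truncation: `a(n)b = 0` for `n` sufficiently large -/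
  trunc : ∀ a b : V, ∃ N : ℤ, ∀ n : ℤ, N ≤ n → ncoef n a b = 0
  /-- the vacuum axiom `Y(𝟙, z) = id`, i.e. `𝟙(n)a = δ_{n,-1} a` -/
  vac_ncoef : ∀ (n : ℤ) (a : V), ncoef n vac a = if n = -1 then a else 0
  /-- creation: `a(-1)𝟙 = a` -/
  ncoef_vac : ∀ a : V, ncoef (-1) a vac = a
  /-- creation: `a(n)𝟙 = 0` for `n ≥ 0` -/
  ncoef_vac_zero : ∀ n : ℤ, 0 ≤ n → ∀ a : V, ncoef n a vac = 0
  /-- the Borcherds identity -/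
  borcherds : ∀ (a b c : V) (p q m : ℤ),
    (∑ᶠ i : ℕ, zBinom K m i •
        ncoef (m + q - (i : ℤ)) (ncoef (p + (i : ℤ)) a b) c)
      = ∑ᶠ i : ℕ, ((-1 : K) ^ i * zBinom K p i) •
          (ncoef (m + p - (i : ℤ)) a (ncoef (q + (i : ℤ)) b c)
            - ((p.negOnePow : ℤ) : K) •
                ncoef (p + q - (i : ℤ)) b (ncoef (m + (i : ℤ)) a c))

namespace VA

variable {K V : Type*} [Field K] [AddCommGroup V] [Module K V]

/-- The translation operator `T a = a(-2)𝟙`. -/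
def T (A : VA K V) : V →ₗ[K] V := (A.ncoef (-2)).flip A.vac

/-- The eigenspace `V_n^a = {v ∈ V | a(1)v = n v}` of `a(1)`. -/
def eig (A : VA K V) (a : V) (n : ℤ) : Submodule K V :=
  LinearMap.ker (A.ncoef 1 a - (n : K) • (LinearMap.id : V →ₗ[K] V))

/-- `a` is a conformal vector: `a(1)a = 2a`, `a(3)a ∈ K𝟙`, `a(2)a = 0`, `a(n)a = 0`
for `n ≥ 4`, `a(0) = T`, and `a(1)` is semisimple with integer eigenvalues
(`V = ⊕_{n ∈ ℤ} V_n^a`). -/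
def IsConformal (A : VA K V) (a : V) : Prop :=
  A.ncoef 1 a a = (2 : K) • a ∧
  (∃ c : K, A.ncoef 3 a a = c • A.vac) ∧
  A.ncoef 2 a a = 0 ∧
  (∀ n : ℤ, 4 ≤ n → A.ncoef n a a = 0) ∧
  A.ncoef 0 a = A.T ∧
  DirectSum.IsInternal (A.eig a)

/-- `a` is a conformal vector of CFT type: `(V, a)` is a VOA of CFT type, i.e.
`V = ⊕_{n ∈ ℕ} V_n^a` with finite-dimensional pieces and `V_0^a = K𝟙`. -/
def IsConformalCFT (A : VA K V) (a : V) : Prop :=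
  A.IsConformal a ∧
  (∀ n : ℤ, n < 0 → A.eig a n = ⊥) ∧
  (∀ n : ℤ, FiniteDimensional K (A.eig a n)) ∧
  A.eig a 0 = Submodule.span K {A.vac}

/-- `a` is a conformal vector of strong CFT type: of CFT type and `a(2)V_1^a = 0`
(i.e. `L^a(1) V_1^a = 0`). -/
def IsConformalSCFT (A : VA K V) (a : V) : Prop :=
  A.IsConformalCFT a ∧ ∀ v ∈ A.eig a 1, A.ncoef 2 a v = 0

/-- A vertex algebra homomorphism: a linear map preserving all products and the vacuum. -/
structure IsVAHom (A : VA K V) (f : V → V) : Prop where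
  map_add : ∀ a b : V, f (a + b) = f a + f b
  map_smul : ∀ (c : K) (a : V), f (c • a) = c • f a
  map_ncoef : ∀ (n : ℤ) (a b : V), f (A.ncoef n a b) = A.ncoef n (f a) (f b)
  map_vac : f A.vac = A.vac

/-- A vertex algebra automorphism: a bijective vertex algebra homomorphism. -/
def IsVAAut (A : VA K V) (f : V → V) : Prop :=
  A.IsVAHom f ∧ Function.Bijective f

/-- A (two-sided) ideal of a vertex algebra. -/
def IsIdeal (A : VA K V) (I : Submodule K V) : Prop :=
  ∀ (n : ℤ) (a : V), ∀ b ∈ I, A.ncoef n a b ∈ I ∧ A.ncoef n b a ∈ I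

/-- A vertex algebra is simple if it has no ideals other than `0` and itself. -/
def IsSimple (A : VA K V) : Prop :=
  ∀ I : Submodule K V, A.IsIdeal I → I = ⊥ ∨ I = ⊤

end VA

/-- The exponential `exp f = Σ_{n≥0} f^n / n!` of an endomorphism, as a function
(meaningful for locally nilpotent `f`). -/
def expOp {K V : Type*} [Field K] [AddCommGroup V] [Module K V]
    (f : V →ₗ[K] V) (v : V) : V :=
  ∑ᶠ n : ℕ, (Nat.factorial n : K)⁻¹ • (f ^ n) v

/-- A ℤ-grading on a vertex algebra, making it a ℤ-graded vertex algebra: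
`V = ⊕_{n ∈ ℤ} V_n`, `V_n(k)V_m ⊆ V_{n+m-k-1}` and `𝟙 ∈ V_0`. -/
structure GradedVA {K V : Type*} [Field K] [AddCommGroup V] [Module K V] (A : VA K V) where
  /-- the grading subspaces `V_n` -/
  gr : ℤ → Submodule K V
  /-- `V = ⊕_{n ∈ ℤ} V_n` -/
  decomp : DirectSum.Decomposition gr
  /-- `𝟙 ∈ V_0` -/
  vac_mem : A.vac ∈ gr 0
  /-- `V_n(k)V_m ⊆ V_{n+m-k-1}` -/
  ncoef_mem : ∀ (n m k : ℤ), ∀ a ∈ gr n, ∀ b ∈ gr m, A.ncoef k a b ∈ gr (n + m - k - 1)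

namespace GradedVA

variable {K V : Type*} [Field K] [AddCommGroup V] [Module K V] {A : VA K V}

/-- The canonical projection `pr_n : V → V_n`. -/
def pr (G : GradedVA A) (n : ℤ) (v : V) : V :=
  letI := G.decomp
  (DirectSum.decompose G.gr v n : V)

/-- `V_{≥n} = ⊕_{i ≥ n} V_i`. -/
def ge (G : GradedVA A) (n : ℤ) : Submodule K V := ⨆ i ≥ n, G.gr i

/-- `V_{≤n} = ⊕_{i ≤ n} V_i`. -/
def le (G : GradedVA A) (n : ℤ) : Submodule K V := ⨆ i ≤ n, G.gr i

/-- `J_1(V) = {a ∈ V_1 | a(0) = 0}`. -/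
def J1 (G : GradedVA A) : Set V :=
  {a : V | a ∈ G.gr 1 ∧ A.ncoef 0 a = 0}

/-- `Aut⁺V`: automorphisms `f` with `f(V_n) ⊆ V_{≥n}` and `pr_n ∘ f|_{V_n} = id`. -/
def AutPlus (G : GradedVA A) (f : V → V) : Prop :=
  A.IsVAAut f ∧ ∀ n : ℤ, ∀ v ∈ G.gr n, f v ∈ G.ge n ∧ G.pr n (f v) = v

/-- `Aut⁻V`: automorphisms `f` with `f(V_n) ⊆ ⊕_{k ≤ n} V_k` and `pr_n ∘ f|_{V_n} = id`. -/
def AutMinus (G : GradedVA A) (f : V → V) : Prop :=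
  A.IsVAAut f ∧ ∀ n : ℤ, ∀ v ∈ G.gr n, f v ∈ G.le n ∧ G.pr n (f v) = v

/-- `Aut⁰V`: automorphisms `f` with `f(V_n) ⊆ V_n`. -/
def AutZero (G : GradedVA A) (f : V → V) : Prop :=
  A.IsVAAut f ∧ ∀ n : ℤ, ∀ v ∈ G.gr n, f v ∈ G.gr n

end GradedVA

/-- A ℤ-graded conformal vertex algebra: a ℤ-graded vertex algebra with a conformal
vector `ω ∈ V_2` whose modes `L(n) = ω(n+1)` satisfy the Virasoro relations, with
`L(0)v = n v` for `v ∈ V_n` and `L(-1) = T`. -/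
structure ConfGVA {K V : Type*} [Field K] [AddCommGroup V] [Module K V] (A : VA K V)
    extends GradedVA A where
  /-- the conformal vector -/
  ω : V
  ω_mem : ω ∈ gr 2
  /-- the Virasoro relations `[L(n), L(m)] = (n-m)L(n+m) + δ_{n+m,0}((n³-n)/12)c` -/
  virasoro : ∃ c : K, ∀ n m : ℤ,
    A.ncoef (n + 1) ω ∘ₗ A.ncoef (m + 1) ω - A.ncoef (m + 1) ω ∘ₗ A.ncoef (n + 1) ω
      = ((n : K) - (m : K)) • A.ncoef (n + m + 1) ω
        + (if n + m = 0 then ((n : K) ^ 3 - (n : K)) / 12 * c else 0)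
            • (LinearMap.id : V →ₗ[K] V)
  /-- `L(0) v = n v` for `v ∈ V_n` -/
  L0_grading : ∀ n : ℤ, ∀ v ∈ gr n, A.ncoef 1 ω v = (n : K) • v
  /-- `L(-1) = T` -/
  Lneg1_eq_T : A.ncoef 0 ω = A.T

namespace ConfGVA

variable {K V : Type*} [Field K] [AddCommGroup V] [Module K V] {A : VA K V}

abbrev pr (C : ConfGVA A) : ℤ → V → V := C.toGradedVA.pr
abbrev ge (C : ConfGVA A) : ℤ → Submodule K V := C.toGradedVA.ge
abbrev le (C : ConfGVA A) : ℤ → Submodule K V := C.toGradedVA.le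
abbrev J1 (C : ConfGVA A) : Set V := C.toGradedVA.J1
abbrev AutPlus (C : ConfGVA A) : (V → V) → Prop := C.toGradedVA.AutPlus
abbrev AutMinus (C : ConfGVA A) : (V → V) → Prop := C.toGradedVA.AutMinus
abbrev AutZero (C : ConfGVA A) : (V → V) → Prop := C.toGradedVA.AutZero

/-- `Aut_ω V`: the VOA automorphisms, i.e. the stabilizer of `ω` in `Aut V`. -/
def AutOmega (C : ConfGVA A) (f : V → V) : Prop :=
  A.IsVAAut f ∧ f C.ω = C.ω

/-- An invariant bilinear form on `(V, ω)`:
`(a(n)b, c) = (-1)^d Σ_{j≥0} (1/j!) (b, (L(1)^j a)(2d-n-2-j) c)` for `a ∈ V_d`, which is the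
coefficient form of `(Y(a,z)b, c) = (b, Y(e^{zL(1)}(-z^{-2})^{L(0)} a, z^{-1}) c)`. -/
def IsInvForm (C : ConfGVA A) (B : V →ₗ[K] V →ₗ[K] K) : Prop :=
  ∀ d : ℤ, ∀ a ∈ C.gr d, ∀ (b c : V) (n : ℤ),
    B (A.ncoef n a b) c
      = ((d.negOnePow : ℤ) : K) *
          ∑ᶠ j : ℕ, (Nat.factorial j : K)⁻¹ *
            B b (A.ncoef (2 * d - n - 2 - (j : ℤ)) ((A.ncoef 2 C.ω ^ j) a) c)

end ConfGVA

/-- A VOA of CFT type: a ℤ-graded conformal vertex algebra with `V = ⊕_{n ∈ ℕ} V_n`,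
`dim V_n < ∞`, and `V_0 = K𝟙`. -/
structure VOACFT {K V : Type*} [Field K] [AddCommGroup V] [Module K V] (A : VA K V)
    extends ConfGVA A where
  gr_neg : ∀ n : ℤ, n < 0 → gr n = ⊥
  gr_fd : ∀ n : ℤ, FiniteDimensional K (gr n)
  gr_zero : gr 0 = Submodule.span K {A.vac}

namespace VOACFT

variable {K V : Type*} [Field K] [AddCommGroup V] [Module K V] {A : VA K V}

abbrev pr (W : VOACFT A) : ℤ → V → V := W.toConfGVA.pr
abbrev ge (W : VOACFT A) : ℤ → Submodule K V := W.toConfGVA.ge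
abbrev le (W : VOACFT A) : ℤ → Submodule K V := W.toConfGVA.le
abbrev J1 (W : VOACFT A) : Set V := W.toConfGVA.J1
abbrev AutPlus (W : VOACFT A) : (V → V) → Prop := W.toConfGVA.AutPlus
abbrev AutMinus (W : VOACFT A) : (V → V) → Prop := W.toConfGVA.AutMinus
abbrev AutZero (W : VOACFT A) : (V → V) → Prop := W.toConfGVA.AutZero
abbrev AutOmega (W : VOACFT A) : (V → V) → Prop := W.toConfGVA.AutOmega
abbrev IsInvForm (W : VOACFT A) : (V →ₗ[K] V →ₗ[K] K) → Prop := W.toConfGVA.IsInvForm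

end VOACFT

/-- A VOA of strong CFT type: a VOA of CFT type with `L(1)V_1 = 0`. -/
structure VOAsCFT {K V : Type*} [Field K] [AddCommGroup V] [Module K V] (A : VA K V)
    extends VOACFT A where
  L1_V1 : ∀ v ∈ gr 1, A.ncoef 2 ω v = 0

namespace VOAsCFT

variable {K V : Type*} [Field K] [AddCommGroup V] [Module K V] {A : VA K V}

abbrev pr (W : VOAsCFT A) : ℤ → V → V := W.toVOACFT.pr
abbrev ge (W : VOAsCFT A) : ℤ → Submodule K V := W.toVOACFT.ge
abbrev le (W : VOAsCFT A) : ℤ → Submodule K V := W.toVOACFT.le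
abbrev J1 (W : VOAsCFT A) : Set V := W.toVOACFT.J1
abbrev AutPlus (W : VOAsCFT A) : (V → V) → Prop := W.toVOACFT.AutPlus
abbrev AutMinus (W : VOAsCFT A) : (V → V) → Prop := W.toVOACFT.AutMinus
abbrev AutZero (W : VOAsCFT A) : (V → V) → Prop := W.toVOACFT.AutZero
abbrev AutOmega (W : VOAsCFT A) : (V → V) → Prop := W.toVOACFT.AutOmega
abbrev IsInvForm (W : VOAsCFT A) : (V →ₗ[K] V →ₗ[K] K) → Prop := W.toVOACFT.IsInvForm

end VOAsCFT

end

namespace Module.End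

variable {K V : Type*} [Field K] [CharZero K] [AddCommGroup V] [Module K V]

/-- Eigenvectors for distinct integer eigenvalues with vanishing sum vanish. -/
theorem eq_zero_of_sum_int_eigenvectors (f : End K V) (s : Finset ℤ) (v : ℤ → V)
    (hv : ∀ k ∈ s, f (v k) = (k : K) • v k) (hsum : ∑ k ∈ s, v k = 0) :
    ∀ k ∈ s, v k = 0 :=
  (iSupIndep_iff_finsetSum_eq_zero_imp_eq_zero _).1
    (f.eigenspaces_iSupIndep.comp (Int.cast_injective (α := K))) s v
    (fun k hk => mem_eigenspace_iff.2 (hv k hk)) hsum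

/-- An invariant subspace containing a sum of eigenvectors for distinct integer eigenvalues
contains each of them. -/
theorem mem_of_sum_int_eigenvectors_mem (f : End K V) (p : Submodule K V)
    (hp : p ≤ p.comap f) (s : Finset ℤ) (v : ℤ → V)
    (hv : ∀ k ∈ s, f (v k) = (k : K) • v k) (hsum : ∑ k ∈ s, v k ∈ p) :
    ∀ k ∈ s, v k ∈ p := fun k hk => by
  rw [← Submodule.Quotient.mk_eq_zero]
  refine eq_zero_of_sum_int_eigenvectors (p.mapQ p f hp) s (fun k => p.mkQ (v k))
    (fun k hk => ?_) ?_ k hk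
  · simp [hv k hk]
  · rw [← map_sum]
    exact (Submodule.Quotient.mk_eq_zero p).2 hsum

end Module.End

namespace VA

variable {K V : Type*} [Field K] [AddCommGroup V] [Module K V] {A : VA K V}

theorem mem_eig {a v : V} {n : ℤ} : v ∈ A.eig a n ↔ A.ncoef 1 a v = (n : K) • v := by
  simp [eig, sub_eq_zero]

theorem isInternal_eig [CharZero K] {a : V} (h : ⨆ n, A.eig a n = ⊤) :
    DirectSum.IsInternal (A.eig a) := by
  refine DirectSum.isInternal_submodule_of_iSupIndep_of_iSup_eq_top ?_ h
  exact (iSupIndep_iff_finsetSum_eq_zero_imp_eq_zero _).2 fun s v hv =>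
    Module.End.eq_zero_of_sum_int_eigenvectors (A.ncoef 1 a) s v fun k hk => mem_eig.1 (hv k hk)

/-- The linear projection onto the `m`-eigenspace of `a(1)`. -/
noncomputable def eigProj {a : V} (h : DirectSum.IsInternal (A.eig a)) (m : ℤ) : V →ₗ[K] V :=
  letI := h.chooseDecomposition
  (A.eig a m).subtype ∘ₗ DirectSum.component K ℤ _ m ∘ₗ
    (DirectSum.decomposeLinearEquiv (A.eig a)).toLinearMap

theorem eigProj_mem {a : V} (h : DirectSum.IsInternal (A.eig a)) (m : ℤ) (v : V) :
    eigProj h m v ∈ A.eig a m :=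
  Submodule.coe_mem _

theorem exists_sum_eigProj {a : V} (h : DirectSum.IsInternal (A.eig a)) (m : ℤ) (v : V) :
    ∃ s : Finset ℤ, m ∈ s ∧ ∑ k ∈ s, eigProj h k v = v := by
  classical
  let := h.chooseDecomposition
  refine ⟨insert m (DirectSum.decompose (A.eig a) v).support, Finset.mem_insert_self _ _, ?_⟩
  conv_rhs => rw [← DirectSum.sum_support_decompose (A.eig a) v]
  symm
  refine Finset.sum_subset (Finset.subset_insert _ _) fun k _ hk => ?_
  simpa using hk

theorem eigProj_mem_of_invariant [CharZero K] {a : V} (h : DirectSum.IsInternal (A.eig a))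
    {p : Submodule K V} (hp : p ≤ p.comap (A.ncoef 1 a)) {v : V} (hv : v ∈ p) (m : ℤ) :
    eigProj h m v ∈ p := by
  obtain ⟨s, hm, hs⟩ := exists_sum_eigProj h m v
  exact Module.End.mem_of_sum_int_eigenvectors_mem (A.ncoef 1 a) p hp s (fun k => eigProj h k v)
    (fun k _ => mem_eig.1 (eigProj_mem h k v)) (by rwa [hs]) m hm

end VA

namespace GradedVA

variable {K V : Type*} [Field K] [AddCommGroup V] [Module K V] {A : VA K V} (G : GradedVA A)

/-- The projection `pr_n` as a linear map. -/
noncomputable def prLinear (n : ℤ) : V →ₗ[K] V :=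
  letI := G.decomp
  (G.gr n).subtype ∘ₗ DirectSum.component K ℤ _ n ∘ₗ
    (DirectSum.decomposeLinearEquiv G.gr).toLinearMap

theorem prLinear_mem (n : ℤ) (v : V) : G.prLinear n v ∈ G.gr n :=
  Submodule.coe_mem _

theorem prLinear_of_mem {m : ℤ} (n : ℤ) {v : V} (hv : v ∈ G.gr m) :
    G.prLinear n v = if m = n then v else 0 := by
  let := G.decomp
  split_ifs with h
  · subst h
    exact DirectSum.decompose_of_mem_same G.gr hv
  · exact DirectSum.decompose_of_mem_ne G.gr hv h

theorem exists_sum_prLinear (v : V) : ∃ s : Finset ℤ, ∑ n ∈ s, G.prLinear n v = v := by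
  classical
  let := G.decomp
  exact ⟨(DirectSum.decompose G.gr v).support, DirectSum.sum_support_decompose G.gr v⟩

theorem eq_zero_of_prLinear {v : V} (h : ∀ n, G.prLinear n v = 0) : v = 0 := by
  obtain ⟨s, hs⟩ := G.exists_sum_prLinear v
  rw [← hs]
  exact Finset.sum_eq_zero fun n _ => h n

theorem iSup_gr : ⨆ n, G.gr n = ⊤ :=
  let := G.decomp
  (DirectSum.Decomposition.isInternal G.gr).submodule_iSup_eq_top

theorem gr_le_ge {m n : ℤ} (h : n ≤ m) : G.gr m ≤ G.ge n :=
  le_iSup₂_of_le m h le_rfl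

theorem ge_induction {n : ℤ} {motive : V → Prop} {v : V} (hv : v ∈ G.ge n)
    (mem : ∀ i ≥ n, ∀ x ∈ G.gr i, motive x) (zero : motive 0)
    (add : ∀ x y, motive x → motive y → motive (x + y)) : motive v :=
  Submodule.iSup_induction _ (motive := motive) hv
    (fun i _ hx => Submodule.iSup_induction _ (motive := motive) hx (mem i) zero add) zero add

theorem mem_ge_iff {n : ℤ} {v : V} : v ∈ G.ge n ↔ ∀ i < n, G.prLinear i v = 0 := by
  refine ⟨fun hv i hi => ?_, fun h => ?_⟩
  · refine G.ge_induction (motive := fun v => G.prLinear i v = 0) hv (fun j hj x hx => ?_)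
      (map_zero _) fun x y hx hy => ?_
    · rw [G.prLinear_of_mem i hx, if_neg (by omega)]
    · rw [map_add, hx, hy, add_zero]
  · obtain ⟨s, hs⟩ := G.exists_sum_prLinear v
    rw [← hs]
    refine Submodule.sum_mem _ fun i _ => ?_
    by_cases hi : i < n
    · rw [h i hi]
      exact zero_mem _
    · exact G.gr_le_ge (not_lt.1 hi) (G.prLinear_mem i v)

theorem prLinear_ncoef_of_ge {p q r : ℤ} {x y : V} (hx : x ∈ G.ge p) (hy : y ∈ G.ge q) (k : ℤ)
    (hr : r ≤ p + q - k - 1) :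
    G.prLinear r (A.ncoef k x y) =
      if r = p + q - k - 1 then A.ncoef k (G.prLinear p x) (G.prLinear q y) else 0 := by
  refine G.ge_induction (motive := fun x => G.prLinear r (A.ncoef k x y) =
      if r = p + q - k - 1 then A.ncoef k (G.prLinear p x) (G.prLinear q y) else 0) hx
    (fun i hi x hx => ?_) (by simp) fun x x' h h' => ?_
  · refine G.ge_induction (motive := fun y => G.prLinear r (A.ncoef k x y) =
      if r = p + q - k - 1 then A.ncoef k (G.prLinear p x) (G.prLinear q y) else 0) hy
      (fun j hj y hy => ?_) (by simp) fun y y' h h' => ?_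
    · rw [G.prLinear_of_mem r (G.ncoef_mem i j k x hx y hy), G.prLinear_of_mem p hx,
        G.prLinear_of_mem q hy]
      by_cases hip : i = p
      · by_cases hjq : j = q
        · subst hip hjq
          simp [eq_comm]
        · rw [if_neg (by omega), if_neg hjq, map_zero, ite_self]
      · rw [if_neg (by omega), if_neg hip, map_zero, LinearMap.zero_apply, ite_self]
    · simp only [map_add, h, h']
      split_ifs <;> simp
  · simp only [map_add, LinearMap.add_apply, h, h']
    split_ifs <;> simp

theorem ncoef_mem_ge {p q : ℤ} {x y : V} (hx : x ∈ G.ge p) (hy : y ∈ G.ge q) (k : ℤ) :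
    A.ncoef k x y ∈ G.ge (p + q - k - 1) :=
  G.mem_ge_iff.2 fun r hr => by
    rw [G.prLinear_ncoef_of_ge hx hy k hr.le, if_neg hr.ne]

/-- The leading component of a product is the product of the leading components. -/
theorem prLinear_ncoef {p q : ℤ} {x y : V} (hx : x ∈ G.ge p) (hy : y ∈ G.ge q) (k : ℤ) :
    G.prLinear (p + q - k - 1) (A.ncoef k x y) =
      A.ncoef k (G.prLinear p x) (G.prLinear q y) := by
  rw [G.prLinear_ncoef_of_ge hx hy k le_rfl, if_pos rfl]

theorem prLinear_ncoef_homogeneous {d : ℤ} {x : V} (hx : x ∈ G.gr d) (k n : ℤ) (y : V) :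
    G.prLinear (d + n - k - 1) (A.ncoef k x y) = A.ncoef k x (G.prLinear n y) := by
  have hy : y ∈ ⨆ n, G.gr n := G.iSup_gr ▸ Submodule.mem_top
  refine Submodule.iSup_induction _ (motive := fun y =>
    G.prLinear (d + n - k - 1) (A.ncoef k x y) = A.ncoef k x (G.prLinear n y)) hy
    (fun j y hy => ?_) (by simp) fun y y' h h' => by simp only [map_add, h, h']
  rw [G.prLinear_of_mem _ (G.ncoef_mem d j k x hx y hy), G.prLinear_of_mem n hy]
  by_cases h : j = n
  · rw [if_pos (by omega), if_pos h]
  · rw [if_neg (by omega), if_neg h, map_zero]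

theorem T_mem {n : ℤ} {v : V} (hv : v ∈ G.gr n) : A.T v ∈ G.gr (n + 1) := by
  have := G.ncoef_mem n 0 (-2) v hv A.vac G.vac_mem
  rwa [show n + 0 - -2 - 1 = n + 1 by ring] at this

theorem pr_mem_gr (n : ℤ) (v : V) : G.pr n v ∈ G.gr n := G.prLinear_mem n v

theorem prLinear_eig {a : V} {m : ℤ} {v : V} (hv : v ∈ A.eig (G.pr 2 a) m) (n : ℤ) :
    G.prLinear n v ∈ A.eig (G.pr 2 a) m := by
  have := G.prLinear_ncoef_homogeneous (G.pr_mem_gr 2 a) 1 n v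
  rw [show (2 : ℤ) + n - 1 - 1 = n by ring, VA.mem_eig.1 hv, map_smul] at this
  exact VA.mem_eig.2 this.symm

section LeadingTerm

variable {a : V} (ha : a ∈ G.ge 2)
include ha

theorem ge_le_comap_ncoef_one (n : ℤ) : G.ge n ≤ (G.ge n).comap (A.ncoef 1 a) := fun v hv => by
  have := G.ncoef_mem_ge ha hv 1
  rwa [show (2 : ℤ) + n - 1 - 1 = n by ring] at this

theorem prLinear_mem_eig {m n : ℤ} {v : V} (hv : v ∈ A.eig a m) (hn : v ∈ G.ge n) :
    G.prLinear n v ∈ A.eig (G.pr 2 a) m := by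
  have := G.prLinear_ncoef ha hn 1
  rw [show (2 : ℤ) + n - 1 - 1 = n by ring, VA.mem_eig.1 hv, map_smul] at this
  exact VA.mem_eig.2 this.symm

variable [CharZero K] (h : DirectSum.IsInternal (A.eig a))

theorem eigProj_mem_ge {n : ℤ} {v : V} (hv : v ∈ G.ge n) (m : ℤ) :
    VA.eigProj h m v ∈ G.ge n :=
  VA.eigProj_mem_of_invariant h (G.ge_le_comap_ncoef_one ha n) hv m

include h in
theorem iSup_eig_pr_two : ⨆ m, A.eig (G.pr 2 a) m = ⊤ := by
  rw [eq_top_iff, ← G.iSup_gr]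
  refine iSup_le fun n v hv => ?_
  obtain ⟨s, -, hs⟩ := VA.exists_sum_eigProj h 0 v
  have hvn := G.prLinear_of_mem n hv
  rw [if_pos rfl, ← hs, map_sum, hs] at hvn
  rw [← hvn]
  exact Submodule.sum_mem _ fun k _ => Submodule.mem_iSup_of_mem k <|
    G.prLinear_mem_eig ha (VA.eigProj_mem h k v)
      (G.eigProj_mem_ge ha h (G.gr_le_ge le_rfl hv) k)

/-- Projecting an eigenvector of `pr_2(a)(1)` to the eigenspace of `a(1)` of the same weight does
not change its leading component. -/
theorem prLinear_eigProj {m n : ℤ} {v : V} (hv : v ∈ A.eig (G.pr 2 a) m) (hn : v ∈ G.ge n) :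
    G.prLinear n (VA.eigProj h m v) = G.prLinear n v := by
  obtain ⟨s, hm, hs⟩ := VA.exists_sum_eigProj h m v
  have := Module.End.eq_zero_of_sum_int_eigenvectors (A.ncoef 1 (G.pr 2 a)) s
    (fun k => G.prLinear n (VA.eigProj h k v) - if k = m then G.prLinear n v else 0)
    (fun k _ => ?_) ?_ m hm
  · simpa [sub_eq_zero] using this
  · refine VA.mem_eig.1 (Submodule.sub_mem _
      (G.prLinear_mem_eig ha (VA.eigProj_mem h k v) (G.eigProj_mem_ge ha h hn k)) ?_)
    split_ifs with hk
    · exact hk ▸ G.prLinear_eig hv n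
    · exact zero_mem _
  · rw [Finset.sum_sub_distrib, ← map_sum, hs, Finset.sum_ite_eq' s m, if_pos hm, sub_self]

theorem eq_zero_of_eigProj_eq_zero (hneg : ∀ n < 0, G.gr n = ⊥) {m : ℤ} {v : V}
    (hv : v ∈ A.eig (G.pr 2 a) m) (h0 : VA.eigProj h m v = 0) : v = 0 := by
  have hge : ∀ n : ℕ, v ∈ G.ge n := fun n => by
    induction n with
    | zero =>
      refine G.mem_ge_iff.2 fun i hi => ?_
      have := G.prLinear_mem i v
      rwa [hneg i (by simpa using hi), Submodule.mem_bot] at this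
    | succ n ih =>
      refine G.mem_ge_iff.2 fun i hi => ?_
      rcases (show i < n ∨ i = n by omega) with hi | rfl
      · exact G.mem_ge_iff.1 ih i hi
      · rw [← G.prLinear_eigProj ha h hv ih, h0, map_zero]
  exact G.eq_zero_of_prLinear fun n => G.mem_ge_iff.1 (hge (n + 1).toNat) n (by omega)

theorem eigProjRestrict_injective (hneg : ∀ n < 0, G.gr n = ⊥) (m : ℤ) :
    Function.Injective ((VA.eigProj h m).restrict
      (p := A.eig (G.pr 2 a) m) (q := A.eig a m) fun v _ => VA.eigProj_mem h m v) := by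
  refine (injective_iff_map_eq_zero _).2 fun v hv => Subtype.ext ?_
  exact G.eq_zero_of_eigProj_eq_zero ha h hneg v.2 (congrArg Subtype.val hv)

theorem isConformal_pr_two (hneg : ∀ n < 0, G.gr n = ⊥)
    (hzero : G.gr 0 = Submodule.span K {A.vac}) (hc : A.IsConformal a) :
    A.IsConformal (G.pr 2 a) := by
  obtain ⟨hc1, -, hc2, -, hc0, hint⟩ := hc
  have hb := G.pr_mem_gr 2 a
  refine ⟨?_, ?_, ?_, fun n hn => ?_, ?_, VA.isInternal_eig (G.iSup_eig_pr_two ha hint)⟩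
  · have := G.prLinear_ncoef ha ha 1
    rw [hc1, map_smul] at this
    exact this.symm
  · have := G.ncoef_mem 2 2 3 _ hb _ hb
    rw [show (2 : ℤ) + 2 - 3 - 1 = 0 by norm_num, hzero, Submodule.mem_span_singleton] at this
    exact this.imp fun c hc => hc.symm
  · have := G.prLinear_ncoef ha ha 2
    rw [hc2, map_zero] at this
    exact this.symm
  · have := G.ncoef_mem 2 2 n _ hb _ hb
    rwa [hneg _ (by omega), Submodule.mem_bot] at this
  · ext v
    have hv : v ∈ ⨆ n, G.gr n := G.iSup_gr ▸ Submodule.mem_top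
    refine Submodule.iSup_induction _ (motive := fun v =>
      A.ncoef 0 (G.pr 2 a) v = A.T v) hv (fun n v hv => ?_) (by simp)
      fun x y hx hy => by rw [map_add, map_add, hx, hy]
    have := G.prLinear_ncoef ha (G.gr_le_ge le_rfl hv) 0
    rw [hc0, show (2 : ℤ) + n - 0 - 1 = n + 1 by ring, G.prLinear_of_mem _ (G.T_mem hv),
      if_pos rfl, G.prLinear_of_mem n hv, if_pos rfl] at this
    exact this.symm

theorem isConformalCFT_pr_two (hneg : ∀ n < 0, G.gr n = ⊥)
    (hzero : G.gr 0 = Submodule.span K {A.vac}) (hc : A.IsConformalCFT a) :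
    A.IsConformalCFT (G.pr 2 a) := by
  obtain ⟨hconf, hneg', hfin, hzero'⟩ := hc
  have hint := hconf.2.2.2.2.2
  have hinj := G.eigProjRestrict_injective ha hint hneg
  have hfin' : ∀ n : ℤ, FiniteDimensional K (A.eig (G.pr 2 a) n) := fun n =>
    have := hfin n
    FiniteDimensional.of_injective _ (hinj n)
  refine ⟨G.isConformal_pr_two ha hneg hzero hconf, fun n hn => ?_, hfin', ?_⟩
  · refine (Submodule.eq_bot_iff _).2 fun v hv =>
      G.eq_zero_of_eigProj_eq_zero ha hint hneg hv ?_
    have := VA.eigProj_mem hint n v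
    rwa [hneg' n hn, Submodule.mem_bot] at this
  · have := hfin 0
    have := hfin' 0
    refine (Submodule.eq_of_le_of_finrank_le ?_ ?_).symm
    · rw [Submodule.span_singleton_le_iff_mem, VA.mem_eig, A.ncoef_vac_zero 1 zero_le_one]
      simp
    · rw [← hzero']
      exact LinearMap.finrank_le_finrank_of_injective (hinj 0)

theorem isConformalSCFT_pr_two (hneg : ∀ n < 0, G.gr n = ⊥)
    (hzero : G.gr 0 = Submodule.span K {A.vac}) (hc : A.IsConformalSCFT a) :
    A.IsConformalSCFT (G.pr 2 a) := by
  obtain ⟨hcft, hone⟩ := hc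
  refine ⟨G.isConformalCFT_pr_two ha hneg hzero hcft, fun v hv => ?_⟩
  have hint := hcft.1.2.2.2.2.2
  obtain ⟨s, hs⟩ := G.exists_sum_prLinear v
  rw [← hs, map_sum]
  refine Finset.sum_eq_zero fun n _ => ?_
  have hn : G.prLinear n v ∈ G.ge n := G.gr_le_ge le_rfl (G.prLinear_mem n v)
  have := G.prLinear_ncoef ha (G.eigProj_mem_ge ha hint hn 1) 2
  rw [hone _ (VA.eigProj_mem hint 1 _), map_zero,
    G.prLinear_eigProj ha hint (G.prLinear_eig hv n) hn,
    G.prLinear_of_mem n (G.prLinear_mem n v), if_pos rfl] at this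
  exact this.symm

end LeadingTerm

end GradedVA

/-- Lemma `pr2s`: in a VOA of CFT type, if `a ∈ CV_sCFT ∩ V_{≥2}`,
then `pr_2(a) ∈ CV_sCFT`. -/
theorem pr2_scft {K V : Type*} [RCLike K] [AddCommGroup V] [Module K V]
    (A : VA K V) (W : VOACFT A) (a : V)
    (h1 : A.IsConformalSCFT a) (h2 : a ∈ W.ge 2) :
    A.IsConformalSCFT (W.pr 2 a) := by
  exact W.isConformalSCFT_pr_two h2 W.gr_neg W.gr_zero h1
end

section
/- If (V, ω) is a simple VOA of strong CFT type, then CV_sCFT ∩ V_2 = {ω}; that is, ω is the unique conformal vector of strong CFT type lying in V_2. -/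
section ZBinom

variable {K : Type*} [Field K]

lemma zBinom_zero_right (m : ℤ) : zBinom K m 0 = 1 := by simp [zBinom]

lemma zBinom_one_right (m : ℤ) : zBinom K m 1 = m := by simp [zBinom]

lemma zBinom_natCast_of_lt {m i : ℕ} (h : m < i) : zBinom K (m : ℤ) i = 0 := by
  rw [zBinom, Finset.prod_eq_zero (Finset.mem_range.2 h) (by simp), zero_div]

variable [CharZero K]

lemma zBinom_neg_one (i : ℕ) : zBinom K (-1) i = (-1) ^ i := by
  rw [zBinom, div_eq_iff (Nat.cast_ne_zero.2 i.factorial_ne_zero)]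
  induction i with
  | zero => simp
  | succ i ih =>
    rw [Finset.prod_range_succ, ih, Nat.factorial_succ]
    push_cast
    ring

lemma zBinom_neg_two (i : ℕ) : zBinom K (-2) i = (-1) ^ i * (i + 1) := by
  rw [zBinom, div_eq_iff (Nat.cast_ne_zero.2 i.factorial_ne_zero)]
  induction i with
  | zero => simp
  | succ i ih =>
    rw [Finset.prod_range_succ, ih, Nat.factorial_succ]
    push_cast
    ring

end ZBinom

namespace VA

variable {K V : Type*} [Field K] [AddCommGroup V] [Module K V] (A : VA K V)

/-- Borcherds' commutator formula for a nonnegative mode. -/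
lemma commutator (a b c : V) (m : ℕ) (q : ℤ) :
    A.ncoef m a (A.ncoef q b c) - A.ncoef q b (A.ncoef m a c) =
      ∑ i ∈ Finset.range (m + 1), zBinom K m i • A.ncoef (m + q - i) (A.ncoef i a b) c := by
  have h := A.borcherds a b c 0 q m
  rw [finsum_eq_sum_of_support_subset (s := Finset.range (m + 1)),
    finsum_eq_single _ 0] at h
  · simpa [zBinom_zero_right] using h.symm
  · intro i hi
    rw [show (0 : ℤ) = ((0 : ℕ) : ℤ) from rfl,
      zBinom_natCast_of_lt (Nat.pos_of_ne_zero hi), mul_zero, zero_smul]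
  · intro i hi
    by_contra hm
    apply hi
    have : m < i := by simpa [Nat.lt_succ_iff] using hm
    simp only [zBinom_natCast_of_lt this, zero_smul]

/-- If every mode of every vector sends `v` into `S`, so do all products of two modes. -/
lemma ncoef_ncoef_mem (S : Submodule K V) (v : V) (hv : ∀ (b : V) (n : ℤ), A.ncoef n b v ∈ S)
    (a b : V) (n q : ℤ) : A.ncoef n a (A.ncoef q b v) ∈ S := by
  obtain ⟨N, hN⟩ := A.trunc b v
  obtain ⟨M, hM⟩ := A.trunc a v
  obtain ⟨k, hk⟩ : ∃ k : ℕ, N - q ≤ k := ⟨(N - q).toNat, Int.self_le_toNat _⟩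
  induction k using Nat.strong_induction_on generalizing n q with
  | _ k ih =>
    have h := A.borcherds a b v (n - M) q M
    have hL : ∑ᶠ i : ℕ, zBinom K M i •
        A.ncoef (M + q - (i : ℤ)) (A.ncoef (n - M + (i : ℤ)) a b) v ∈ S :=
      finsum_induction (· ∈ S) S.zero_mem (fun _ _ => S.add_mem)
        fun i => S.smul_mem _ (hv _ _)
    rw [h, finsum_eq_sum_of_support_subset (s := Finset.range (k + 1)),
      Finset.sum_range_succ'] at hL
    · rw [S.add_mem_iff_right] at hL
      · simpa [zBinom_zero_right, hM] using hL
      · refine S.sum_mem fun i _ => S.smul_mem _ ?_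
        rw [hM (M + ((i + 1 : ℕ) : ℤ)) (by lia), map_zero, smul_zero, sub_zero]
        by_cases hq : N ≤ q + ((i + 1 : ℕ) : ℤ)
        · rw [hN _ hq, map_zero]
          exact S.zero_mem
        · exact ih (N - (q + ((i + 1 : ℕ) : ℤ))).toNat (by lia) _ _ (by lia)
    · intro i hi
      by_contra hm
      apply hi
      have : k < i := by simpa [Nat.lt_succ_iff] using hm
      simp only [hM (M + (i : ℤ)) (by lia), hN (q + (i : ℤ)) (by lia), map_zero, smul_zero,
        sub_zero]

variable [CharZero K]

lemma T_ncoef_succ (a c : V) (q : ℕ) :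
    A.ncoef (q + 1) (A.T a) c = -((q : K) + 1) • A.ncoef q a c := by
  have h := A.borcherds a A.vac c (-2) (q + 1) 0
  rw [finsum_eq_single _ 0, finsum_eq_single _ q] at h
  · have e : (-2 + ((q : ℤ) + 1) - q) = -1 := by ring
    have e2 : ¬ ((q : ℤ) + 1 + q = -1) := by lia
    have e3 : ((-1 : K) ^ q * ((-1) ^ q * ((q : K) + 1))) = q + 1 := by
      rw [← mul_assoc, ← mul_pow]; simp
    rw [neg_smul]
    simpa [zBinom_zero_right, zBinom_neg_two, A.vac_ncoef, e, e2, e3, T,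
      Int.negOnePow_even (-2) (by decide)] using h
  · intro i hi
    have e1 : ¬ ((q : ℤ) + 1 + i = -1) := by lia
    have e2 : ¬ (-2 + ((q : ℤ) + 1) - i = -1) := by lia
    simp [A.vac_ncoef, e1, e2]
  · intro i hi
    rw [show (0 : ℤ) = ((0 : ℕ) : ℤ) from rfl,
      zBinom_natCast_of_lt (Nat.pos_of_ne_zero hi), zero_smul]

lemma T_ncoef_neg (a c : V) (q : ℕ) :
    A.ncoef (-1 - q) (A.T a) c = ((q : K) + 1) • A.ncoef (-2 - q) a c := by
  have h := A.borcherds a A.vac c (-2) (-1 - q) 0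
  rw [finsum_eq_single _ 0, finsum_eq_single _ q] at h
  · have e2 : ¬ (-2 + (-1 - (q : ℤ)) - q = -1) := by lia
    have e3 : ((-1 : K) ^ q * ((-1) ^ q * ((q : K) + 1))) = q + 1 := by
      rw [← mul_assoc, ← mul_pow]; simp
    simpa [zBinom_zero_right, zBinom_neg_two, A.vac_ncoef, e2, e3, T] using h
  · intro i hi
    have e1 : ¬ (-1 - (q : ℤ) + i = -1) := by lia
    have e2 : ¬ (-2 + (-1 - (q : ℤ)) - i = -1) := by lia
    simp [A.vac_ncoef, e1, e2]
  · intro i hi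
    rw [show (0 : ℤ) = ((0 : ℕ) : ℤ) from rfl,
      zBinom_natCast_of_lt (Nat.pos_of_ne_zero hi), zero_smul]

/-- Skew-symmetry, with `T^i / i!` written as the `(-1-i)`-th product with the vacuum. -/
lemma skew (a b : V) (p : ℤ) :
    A.ncoef p b a = -((p.negOnePow : ℤ) : K) •
      ∑ᶠ i : ℕ, (-1 : K) ^ i • A.ncoef (-1 - i) (A.ncoef (p + i) a b) A.vac := by
  have h := A.borcherds a b A.vac p 0 (-1)
  rw [finsum_eq_single (fun i : ℕ => ((-1 : K) ^ i * zBinom K p i) • _) 0] at h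
  · simp only [zBinom_neg_one, add_zero] at h
    rw [h]
    simp [zBinom_zero_right, A.ncoef_vac, A.ncoef_vac_zero, smul_smul, ← mul_pow]
  · intro i hi
    rw [A.ncoef_vac_zero _ (by lia), A.ncoef_vac_zero _ (by lia)]
    simp

lemma ncoef_neg_vac_mem (J : Submodule K V) (hJ : ∀ x ∈ J, A.T x ∈ J) (i : ℕ) :
    ∀ x ∈ J, A.ncoef (-1 - i) x A.vac ∈ J := by
  induction i with
  | zero => intro x hx; simpa [A.ncoef_vac] using hx
  | succ i ih =>
    intro x hx
    have h := ih _ (hJ x hx)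
    rw [T_ncoef_neg, J.smul_mem_iff (by exact_mod_cast i.succ_ne_zero)] at h
    have e : (-1 : ℤ) - ((i + 1 : ℕ) : ℤ) = -2 - i := by
      push_cast
      ring
    rwa [e]

/-- A left ideal stable under `T` is an ideal. -/
lemma IsIdeal.of_left {J : Submodule K V} (hT : ∀ x ∈ J, A.T x ∈ J)
    (hJ : ∀ (n : ℤ) (a : V), ∀ b ∈ J, A.ncoef n a b ∈ J) : A.IsIdeal J := by
  refine fun n a b hb => ⟨hJ n a b hb, ?_⟩
  rw [A.skew a b n]
  exact J.smul_mem _ <| finsum_induction (· ∈ J) J.zero_mem (fun _ _ => J.add_mem)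
    fun i => J.smul_mem _ (A.ncoef_neg_vac_mem J hT i _ (hJ _ _ _ hb))

end VA

namespace GradedVA

variable {K V : Type*} [Field K] [AddCommGroup V] [Module K V] {A : VA K V} (G : GradedVA A)

/-- The projection `pr_n` as a linear map. -/
def proj (n : ℤ) : V →ₗ[K] V :=
  letI := G.decomp
  (G.gr n).subtype ∘ₗ DirectSum.component K ℤ (fun i => G.gr i) n ∘ₗ
    (DirectSum.decomposeLinearEquiv G.gr).toLinearMap

lemma proj_mem (n : ℤ) (v : V) : G.proj n v ∈ G.gr n := by simp [proj]

lemma proj_of_mem {n : ℤ} {v : V} (hv : v ∈ G.gr n) : G.proj n v = v :=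
  letI := G.decomp
  DirectSum.decompose_of_mem_same G.gr hv

lemma proj_of_mem_ne {m n : ℤ} {v : V} (hv : v ∈ G.gr m) (h : m ≠ n) : G.proj n v = 0 :=
  letI := G.decomp
  DirectSum.decompose_of_mem_ne G.gr hv h

lemma eq_zero_of_mem {m n : ℤ} {v : V} (h : m ≠ n) (hm : v ∈ G.gr m) (hn : v ∈ G.gr n) :
    v = 0 := by
  rw [← G.proj_of_mem hn, G.proj_of_mem_ne hm h]

lemma induction {p : V → Prop} (h0 : p 0) (hadd : ∀ x y, p x → p y → p (x + y))
    (hgr : ∀ n, ∀ x ∈ G.gr n, p x) (v : V) : p v :=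
  letI := G.decomp
  DirectSum.Decomposition.inductionOn G.gr h0 (fun x => hgr _ x x.2) hadd v

lemma eq_zero_of_proj {v : V} (h : ∀ n, G.proj n v = 0) : v = 0 := by
  let := G.decomp
  apply (DirectSum.decompose G.gr).injective
  rw [DirectSum.decompose_zero]
  ext n
  exact h n

lemma proj_map (f : V →ₗ[K] V) (hf : ∀ n, ∀ v ∈ G.gr n, f v ∈ G.gr n) (n : ℤ) (v : V) :
    G.proj n (f v) = f (G.proj n v) := by
  refine G.induction (p := fun v => G.proj n (f v) = f (G.proj n v)) (by simp)
    (fun x y hx hy => by simp only [map_add, hx, hy]) (fun m x hx => ?_) v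
  obtain rfl | h := eq_or_ne m n
  · rw [G.proj_of_mem hx, G.proj_of_mem (hf _ _ hx)]
  · rw [G.proj_of_mem_ne hx h, G.proj_of_mem_ne (hf _ _ hx) h, map_zero]

lemma isInternal : DirectSum.IsInternal G.gr :=
  letI := G.decomp
  DirectSum.Decomposition.isInternal G.gr

lemma ncoef_mem' {n m k d : ℤ} {a b : V} (ha : a ∈ G.gr n) (hb : b ∈ G.gr m)
    (h : n + m - k - 1 = d) : A.ncoef k a b ∈ G.gr d :=
  h ▸ G.ncoef_mem n m k a ha b hb

end GradedVA

lemma ConfGVA.eig_ω {K V : Type*} [Field K] [CharZero K] [AddCommGroup V] [Module K V]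
    {A : VA K V} (C : ConfGVA A) : A.eig C.ω = C.gr := by
  funext n
  ext v
  have hmem : v ∈ A.eig C.ω n ↔ A.ncoef 1 C.ω v = (n : K) • v := by simp [VA.eig, sub_eq_zero]
  rw [hmem]
  refine ⟨fun h => ?_, C.L0_grading n v⟩
  suffices v - C.proj n v = 0 by
    rw [sub_eq_zero.1 this]
    exact C.proj_mem n v
  refine C.eq_zero_of_proj fun m => ?_
  obtain rfl | hmn := eq_or_ne n m
  · rw [map_sub, C.proj_of_mem (C.proj_mem _ _), sub_self]
  · rw [map_sub, C.proj_of_mem_ne (C.proj_mem _ _) hmn, sub_zero]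
    have h1 := C.proj_map (A.ncoef 1 C.ω) (fun k x hx => C.ncoef_mem' C.ω_mem hx (by ring)) m v
    rw [h, C.L0_grading m _ (C.proj_mem m v), map_smul, ← sub_eq_zero, ← sub_smul,
      smul_eq_zero, sub_eq_zero] at h1
    exact h1.resolve_left fun e => hmn (by exact_mod_cast e)

namespace VOACFT

variable {K V : Type*} [Field K] [AddCommGroup V] [Module K V] {A : VA K V} (W : VOACFT A)

lemma eq_zero_of_mem_gr_neg {n : ℤ} (hn : n < 0) {v : V} (hv : v ∈ W.gr n) : v = 0 := by
  rwa [W.gr_neg n hn, Submodule.mem_bot] at hv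

lemma eq_smul_vac {v : V} (hv : v ∈ W.gr 0) : ∃ c : K, c • A.vac = v := by
  rwa [W.gr_zero, Submodule.mem_span_singleton] at hv

lemma ω_two_ω : A.ncoef 2 W.ω W.ω = 0 := by
  obtain ⟨c, hc⟩ := W.virasoro
  have h := congrArg (fun f : V →ₗ[K] V => f A.vac) (hc 1 (-2))
  simpa [A.ncoef_vac, A.ncoef_vac_zero] using h

variable [CharZero K]

lemma isConformalCFT_ω : A.IsConformalCFT W.ω := by
  refine ⟨⟨?_, ?_, W.ω_two_ω, fun n hn => ?_, W.Lneg1_eq_T, ?_⟩, ?_⟩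
  · exact_mod_cast W.L0_grading 2 W.ω W.ω_mem
  · obtain ⟨c, hc⟩ := W.eq_smul_vac (W.ncoef_mem' W.ω_mem W.ω_mem (k := 3) (by norm_num))
    exact ⟨c, hc.symm⟩
  · exact W.eq_zero_of_mem_gr_neg (by lia) (W.ncoef_mem 2 2 n _ W.ω_mem _ W.ω_mem)
  · rw [W.eig_ω]
    exact W.isInternal
  · rw [W.eig_ω]
    exact ⟨W.gr_neg, W.gr_fd, W.gr_zero⟩

/-- Skew-symmetry for a product landing in the lowest weight. -/
lemma ncoef_swap_eq_zero {j k : ℤ} {a b : V} (ha : a ∈ W.gr j) (hb : b ∈ W.gr k)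
    {n : ℤ} (hn : n = j + k - 1) (h : A.ncoef n a b = 0) : A.ncoef n b a = 0 := by
  rw [A.skew a b n, finsum_eq_zero_of_forall_eq_zero, smul_zero]
  intro i
  have : A.ncoef (n + i) a b = 0 := by
    obtain rfl | hi := Nat.eq_zero_or_pos i
    · simpa using h
    · exact W.eq_zero_of_mem_gr_neg (by lia) (W.ncoef_mem j k _ a ha b hb)
  simp [this]

/-- The largest ideal with vanishing weight-zero component. -/
def radical : Submodule K V where
  carrier := {v | ∀ (b : V) (n : ℤ), A.ncoef n b v ∈ LinearMap.ker (W.proj 0)}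
  zero_mem' := by simp
  add_mem' := by
    intro x y hx hy b n
    rw [map_add]
    exact Submodule.add_mem _ (hx b n) (hy b n)
  smul_mem' := by
    intro c x hx b n
    rw [map_smul]
    exact Submodule.smul_mem _ c (hx b n)

lemma isIdeal_radical : A.IsIdeal W.radical := by
  have hleft : ∀ (n : ℤ) (a : V), ∀ b ∈ W.radical, A.ncoef n a b ∈ W.radical :=
    fun n a b hb c m => A.ncoef_ncoef_mem _ b hb c a m n
  refine VA.IsIdeal.of_left A (fun x hx => ?_) hleft
  rw [← W.Lneg1_eq_T]
  exact hleft 0 _ x hx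

lemma radical_eq_bot (hs : A.IsSimple) : W.radical = ⊥ := by
  obtain h | h := hs _ W.isIdeal_radical
  · exact h
  · have h1 : A.vac ∈ W.radical := h ▸ Submodule.mem_top
    have h2 : A.vac = 0 := by
      simpa [A.ncoef_vac, W.proj_of_mem W.vac_mem] using h1 A.vac (-1)
    rw [Submodule.eq_bot_iff]
    intro x _
    rw [← A.ncoef_vac x, h2, map_zero]

end VOACFT

namespace VOAsCFT

variable {K V : Type*} [Field K] [CharZero K] [AddCommGroup V] [Module K V] {A : VA K V}
  (W : VOAsCFT A)

lemma L1_commutator {u : V} (hu : u ∈ W.gr 1) (b : V) (n : ℕ) :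
    A.ncoef 2 W.ω (A.ncoef n u b) - A.ncoef n u (A.ncoef 2 W.ω b) =
      -(n : K) • A.ncoef (n + 1) u b := by
  have h := A.commutator W.ω u b 2 n
  have e1 : ((2 : ℕ) : ℤ) + n - (0 : ℕ) = ((n + 1 : ℕ) : ℤ) + 1 := by push_cast; ring
  have e2 : ((2 : ℕ) : ℤ) + n - (1 : ℕ) = n + 1 := by push_cast; ring
  have e3 : A.ncoef ((1 : ℕ) : ℤ) W.ω u = u := by simpa using W.L0_grading 1 u hu
  have e4 : A.ncoef ((2 : ℕ) : ℤ) W.ω u = 0 := W.L1_V1 u hu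
  have e5 : A.ncoef ((0 : ℕ) : ℤ) W.ω u = A.T u := by rw [Nat.cast_zero, W.Lneg1_eq_T]
  rw [Finset.sum_range_succ, Finset.sum_range_succ, Finset.sum_range_one, e3, e4, e5, e1, e2,
    A.T_ncoef_succ, zBinom_zero_right, zBinom_one_right] at h
  simp only [map_zero, LinearMap.zero_apply, smul_zero, add_zero, Nat.cast_ofNat] at h
  rw [h]
  push_cast
  module

lemma ncoef_eq_zero_of_weight_eq {u : V} (hu : u ∈ W.gr 1)
    (h1 : ∀ b ∈ W.gr 1, A.ncoef 1 u b = 0) (k : ℕ) :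
    ∀ b ∈ W.gr k, A.ncoef k u b = 0 := by
  induction k with
  | zero =>
    intro b hb
    obtain ⟨c, rfl⟩ := W.eq_smul_vac hb
    rw [map_smul, A.ncoef_vac_zero _ (by simp), smul_zero]
  | succ k ih =>
    intro b hb
    obtain rfl | hk := Nat.eq_zero_or_pos k
    · exact h1 b (by simpa using hb)
    · have h := W.L1_commutator hu b k
      rw [W.L1_V1 _ (W.ncoef_mem' hu hb (by push_cast; ring)),
        ih _ (W.ncoef_mem' W.ω_mem hb (by push_cast; ring)), sub_zero, eq_comm,
        smul_eq_zero, neg_eq_zero, Nat.cast_eq_zero] at h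
      exact_mod_cast h.resolve_left hk.ne'

lemma eq_zero_of_ncoef_one (hs : A.IsSimple) {u : V} (hu : u ∈ W.gr 1)
    (h1 : ∀ b ∈ W.gr 1, A.ncoef 1 u b = 0) : u = 0 := by
  suffices u ∈ W.radical by rwa [W.radical_eq_bot hs, Submodule.mem_bot] at this
  intro b n
  rw [LinearMap.mem_ker]
  refine W.induction (p := fun b => W.proj 0 (A.ncoef n b u) = 0) (by simp)
    (fun x y hx hy => by simp [hx, hy]) (fun k x hx => ?_) b
  obtain rfl | hkn := eq_or_ne k n
  · obtain hk | hk := lt_or_ge k 0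
    · simp [W.eq_zero_of_mem_gr_neg hk hx]
    · lift k to ℕ using hk
      rw [W.ncoef_swap_eq_zero hu hx (by ring) (W.ncoef_eq_zero_of_weight_eq hu h1 k x hx),
        map_zero]
  · exact W.proj_of_mem_ne (W.ncoef_mem k 1 n x hx u hu) (by lia)

variable {a : V}

lemma conformal_two_eq_zero (ha : A.IsConformalSCFT a) (h2 : a ∈ W.gr 2) {b : V}
    (hb : b ∈ W.gr 1) : A.ncoef 2 a b = 0 := by
  obtain ⟨⟨⟨h11, -, -, -, h0, hint⟩, -⟩, hsc⟩ := ha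
  have hcomm : ∀ c : V, A.ncoef 1 a (A.ncoef 2 a c) - A.ncoef 2 a (A.ncoef 1 a c) =
      -A.ncoef 2 a c := by
    intro c
    have h := A.commutator a a c 1 2
    have hT := A.T_ncoef_succ a c 2
    rw [Finset.sum_range_succ, Finset.sum_range_one, zBinom_zero_right, zBinom_one_right] at h
    norm_num [h0, h11] at h hT
    rw [h, hT]
    module
  suffices ∀ v : V, A.ncoef 2 a (W.proj 1 v) = 0 by
    simpa [W.proj_of_mem hb] using this b
  intro v
  have hv : v ∈ ⨆ k, A.eig a k := hint.submodule_iSup_eq_top ▸ Submodule.mem_top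
  refine Submodule.iSup_induction _ (motive := fun v => A.ncoef 2 a (W.proj 1 v) = 0) hv
    (fun k x hx => ?_) (by simp) (fun x y hx hy => by simp [hx, hy])
  have hx' : A.ncoef 1 a x = (k : K) • x := by simpa [VA.eig, sub_eq_zero] using hx
  have hp : A.ncoef 1 a (W.proj 1 x) = (k : K) • W.proj 1 x := by
    rw [← W.proj_map (A.ncoef 1 a) (fun n y hy => W.ncoef_mem' h2 hy (by ring)), hx', map_smul]
  obtain rfl | hk := eq_or_ne k 1
  · exact hsc _ (by simpa [VA.eig, sub_eq_zero] using hp)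
  · have h := hcomm (W.proj 1 x)
    obtain ⟨c, hc⟩ := W.eq_smul_vac (W.ncoef_mem' h2 (W.proj_mem 1 x) (k := 2) (by norm_num))
    rw [hp, ← hc, map_smul, A.ncoef_vac_zero _ (by simp), map_smul, ← hc] at h
    have h' : ((k : K) - 1) • (c • A.vac) = 0 := by
      linear_combination (norm := module) -h
    rw [← hc]
    exact (smul_eq_zero.1 h').resolve_left fun e => hk (by exact_mod_cast sub_eq_zero.1 e)

/-- Conformal vectors of CFT type in `V_2` differ from `ω` by a derivative of a weight-one
vector. -/
lemma exists_sub_eq_T (ha : A.IsConformalCFT a) (h2 : a ∈ W.gr 2) :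
    ∃ u ∈ W.gr 1, W.ω - a = A.T u := by
  obtain ⟨⟨h11, -, -, -, h0, -⟩, hneg, -, hzero⟩ := ha
  have hw : A.ncoef 2 W.ω a ∈ W.gr 1 := W.ncoef_mem' W.ω_mem h2 (by norm_num)
  have hswap : A.ncoef 1 a W.ω = (2 : K) • a - A.T (A.ncoef 2 W.ω a) := by
    rw [A.skew W.ω a 1, finsum_eq_sum_of_support_subset (s := Finset.range 2)]
    · have h := W.L0_grading 2 a h2
      push_cast at h
      simp [Finset.sum_range_succ, A.ncoef_vac, h, VA.T, sub_eq_add_neg]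
    · intro i hi
      by_contra hm
      apply hi
      have hi2 : 1 < i := by simpa using hm
      obtain rfl | hi3 : i = 2 ∨ 2 < i := by lia
      · obtain ⟨c, hc⟩ := W.eq_smul_vac (W.ncoef_mem' W.ω_mem h2 (k := 3) (by norm_num))
        simp [← hc, A.vac_ncoef]
      · have : A.ncoef (1 + (i : ℤ)) W.ω a = 0 :=
          W.eq_zero_of_mem_gr_neg (by lia) (W.ncoef_mem 2 2 _ _ W.ω_mem _ h2)
        simp [this]
  have hT : ∀ c : V, A.ncoef 1 a (A.T c) = A.T (A.ncoef 1 a c + c) := by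
    intro c
    have h := A.commutator a a c 0 1
    have hT := A.T_ncoef_succ a c 0
    rw [Finset.sum_range_one, zBinom_zero_right] at h
    norm_num [h0] at h hT
    rw [hT] at h
    rw [map_add]
    linear_combination (norm := module) -h
  have hTmem : ∀ c ∈ W.gr 1, A.T c ∈ W.gr 2 := by
    intro c hc
    rw [← h0]
    exact W.ncoef_mem' h2 hc (by norm_num)
  obtain ⟨u, hu, huw⟩ : ∃ u ∈ W.gr 1, A.ncoef 1 a u + u = -A.ncoef 2 W.ω a := by
    have := W.gr_fd 1
    let f : V →ₗ[K] V := A.ncoef 1 a + LinearMap.id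
    have hf : ∀ x ∈ W.gr 1, f x ∈ W.gr 1 := fun x hx =>
      (W.gr 1).add_mem (W.ncoef_mem' h2 hx (by norm_num)) hx
    have hinj : Function.Injective (f.restrict hf) := by
      rw [← LinearMap.ker_eq_bot, Submodule.eq_bot_iff]
      intro x hx
      have hx' : (x : V) ∈ A.eig a (-1) := by
        have := congrArg Subtype.val (LinearMap.mem_ker.1 hx)
        simpa [VA.eig, f] using this
      rw [hneg _ (by norm_num), Submodule.mem_bot] at hx'
      exact Subtype.ext hx'
    obtain ⟨u, hu⟩ := LinearMap.injective_iff_surjective.1 hinj ⟨_, (W.gr 1).neg_mem hw⟩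
    exact ⟨u, u.2, congrArg Subtype.val hu⟩
  refine ⟨u, hu, ?_⟩
  have hmem2 : W.ω - a - A.T u ∈ W.gr 2 :=
    (W.gr 2).sub_mem ((W.gr 2).sub_mem W.ω_mem h2) (hTmem u hu)
  have hmem0 : W.ω - a - A.T u ∈ A.eig a 0 := by
    simp only [VA.eig, Int.cast_zero, zero_smul, sub_zero, LinearMap.mem_ker, map_sub, hswap,
      h11, hT, huw, map_neg]
    abel
  rw [hzero, ← W.gr_zero] at hmem0
  exact sub_eq_zero.1 (W.eq_zero_of_mem (by norm_num) hmem0 hmem2)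

end VOAsCFT

/-- Lemma `scft`: if `(V, ω)` is a simple VOA of strong CFT type,
then `CV_sCFT ∩ V_2 = {ω}`. -/
theorem scft_conformal_in_V2_unique {K V : Type*} [RCLike K]
    [AddCommGroup V] [Module K V]
    (A : VA K V) (W : VOAsCFT A) (hs : A.IsSimple) :
    {a : V | A.IsConformalSCFT a ∧ a ∈ W.gr 2} = {W.ω} := by
  refine Set.eq_singleton_iff_unique_mem.2 ⟨⟨⟨W.isConformalCFT_ω, ?_⟩, W.ω_mem⟩, ?_⟩
  · rw [W.eig_ω]
    exact W.L1_V1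
  · rintro a ⟨ha, h2⟩
    obtain ⟨u, hu, hau⟩ := W.exists_sub_eq_T ha.1 h2
    have hu0 : u = 0 := by
      refine W.eq_zero_of_ncoef_one hs hu fun b hb => ?_
      have h := A.T_ncoef_succ u b 1
      rw [← hau] at h
      norm_num [W.L1_V1 b hb, W.conformal_two_eq_zero ha h2 hb] at h
      exact h
    rw [hu0, map_zero, sub_eq_zero] at hau
    exact hau.symm
end
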